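/- Suppose additionally that r_i < 10^{-4}·m_i^2 for every i. Then for every i ≥ 1 and every monomial w in P of degree m_i, there exist nonnegative integers n1,...,n6 with n1+...+n6 = m_i such that R_i(w(n1,...,n6)) does not lie in R_i(S(w)) (the image of S(w) under R_i). -/

import Mathlib

open scoped Classical BigOperators

noncomputable section

/-- The free associative unital `K`-algebra on six generators `x1 x2 x3 y1 y2 y3`,
realized as the monoid algebra of the free monoid on six letters. -/
abbrev FreeA (K : Type) [Field K] : Type := MonoidAlgebra K (FreeMonoid (Fin 6))

/-- The map sending the generators `x1 x2 x3` to `x` and `y1 y2 y3` to `y`. -/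
def bf : Fin 6 → Fin 2 := fun i => if (i : ℕ) < 3 then 0 else 1

/-- The monoid homomorphism `β` from monomials in six letters to monomials in two letters. -/
def bm : FreeMonoid (Fin 6) →* FreeMonoid (Fin 2) := FreeMonoid.map bf

/-- Degree (length) of a monomial. -/
def len {α : Type} (w : FreeMonoid α) : ℕ := (FreeMonoid.toList w).length

/-- The ordering `≺` on monomials in `x, y`: same degree and lexicographically smaller. -/
def prec (z z' : FreeMonoid (Fin 2)) : Prop :=
  len z = len z' ∧ List.Lex (· < ·) (FreeMonoid.toList z) (FreeMonoid.toList z')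

/-- The finite set of monomials of degree `n` in six letters. -/
def wordsOf (n : ℕ) : Finset (FreeMonoid (Fin 6)) :=
  (Finset.univ : Finset (Fin n → Fin 6)).image fun f => FreeMonoid.ofList (List.ofFn f)

/-- `wComp K z n` is `z(n₁,…,n₆)`: the sum of all monomials `v` (in six letters) with
`β v = z` and with exactly `nᵢ` occurrences of the `i`-th generator; it is `0` if no such
monomial exists (in particular if some `nᵢ` is negative). -/
def wComp (K : Type) [Field K] (z : FreeMonoid (Fin 2)) (n : Fin 6 → ℤ) : FreeA K :=
  ∑ v ∈ (wordsOf (len z)).filter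
      (fun v => bm v = z ∧ ∀ e : Fin 6, ((FreeMonoid.toList v).count e : ℤ) = n e),
    MonoidAlgebra.single v 1

/-- `H_i`: the `K`-span of the monomials of degree `i`. -/
def Hgr (K : Type) [Field K] (i : ℕ) : Submodule K (FreeA K) :=
  Submodule.span K {a | ∃ w : FreeMonoid (Fin 6), len w = i ∧ a = MonoidAlgebra.single w (1 : K)}

/-- `S(z)` for `z` a monomial in `x, y`: the span of the monomials `w` in six letters of the
same degree with `β w ≺ z`.  (For a monomial `z` in six letters, `S(z) = SP K (bm z)`.) -/
def SP (K : Type) [Field K] (z : FreeMonoid (Fin 2)) : Submodule K (FreeA K) :=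
  Submodule.span K
    {a | ∃ w : FreeMonoid (Fin 6), len w = len z ∧ prec (bm w) z ∧
      a = MonoidAlgebra.single w (1 : K)}

/-- `Q(z)`: the span of the monomials `w` of the same degree with `β w = z`. -/
def QP (K : Type) [Field K] (z : FreeMonoid (Fin 2)) : Submodule K (FreeA K) :=
  Submodule.span K
    {a | ∃ w : FreeMonoid (Fin 6), len w = len z ∧ bm w = z ∧
      a = MonoidAlgebra.single w (1 : K)}

end

noncomputable section

variable {K : Type} [Field K]

lemma len_mul {α : Type} (u v : FreeMonoid α) : len (u * v) = len u + len v := by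
  simp [len]

lemma len_bm (v : FreeMonoid (Fin 6)) : len (bm v) = len v := by
  simp [len, bm]

lemma mem_wordsOf {n : ℕ} {v : FreeMonoid (Fin 6)} : v ∈ wordsOf n ↔ len v = n := by
  simp only [wordsOf, Finset.mem_image, Finset.mem_univ, true_and]
  constructor
  · rintro ⟨f, rfl⟩
    simp [len]
  · rintro rfl
    exact ⟨(FreeMonoid.toList v).get, FreeMonoid.toList.injective (List.ofFn_get _)⟩

/-- The first `p` letters of a word. -/
def takeW {α : Type} (p : ℕ) (v : FreeMonoid α) : FreeMonoid α :=
  FreeMonoid.ofList ((FreeMonoid.toList v).take p)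

/-- The word that remains after the first `p` letters. -/
def dropW {α : Type} (p : ℕ) (v : FreeMonoid α) : FreeMonoid α :=
  FreeMonoid.ofList ((FreeMonoid.toList v).drop p)

lemma takeW_mul_dropW {α : Type} (p : ℕ) (v : FreeMonoid α) : takeW p v * dropW p v = v := by
  simp [takeW, dropW, ← FreeMonoid.ofList_append]

lemma takeW_mul {α : Type} {p : ℕ} {u : FreeMonoid α} (h : len u = p) (v : FreeMonoid α) :
    takeW p (u * v) = u := by
  subst h
  simp [takeW, len]

lemma dropW_mul {α : Type} {p : ℕ} {u : FreeMonoid α} (h : len u = p) (v : FreeMonoid α) :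
    dropW p (u * v) = v := by
  subst h
  simp [dropW, len]

lemma len_takeW {α : Type} {p q : ℕ} {v : FreeMonoid α} (h : len v = p + q) :
    len (takeW p v) = p := by
  simp [takeW, len] at h ⊢
  omega

lemma len_dropW {α : Type} {p q : ℕ} {v : FreeMonoid α} (h : len v = p + q) :
    len (dropW p v) = q := by
  simp [dropW, len] at h ⊢
  omega

lemma mul_inj_of_len {α : Type} {u u' v v' : FreeMonoid α} (h : len u = len u')
    (e : u * v = u' * v') : u = u' ∧ v = v' :=
  ⟨by rw [← takeW_mul h v, e, takeW_mul rfl], by rw [← dropW_mul h v, e, dropW_mul rfl]⟩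

lemma not_prec_self (z : FreeMonoid (Fin 2)) : ¬ prec z z := by
  rintro ⟨-, h⟩
  exact List.lt_irrefl (FreeMonoid.toList z) h

lemma List.Lex.of_append {α : Type} {r : α → α → Prop} : ∀ {l₁ l₂ t₁ t₂ : List α},
    l₁.length = l₂.length → List.Lex r (l₁ ++ t₁) (l₂ ++ t₂) →
      List.Lex r l₁ l₂ ∨ (l₁ = l₂ ∧ List.Lex r t₁ t₂)
  | [], [], _, _, _, h => Or.inr ⟨rfl, h⟩
  | a :: l₁, b :: l₂, _, _, hl, h => by
    rw [List.cons_append, List.cons_append] at h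
    cases h with
    | rel h => exact Or.inl (.rel h)
    | cons h =>
      rcases List.Lex.of_append (by simpa using hl) h with h' | ⟨rfl, h'⟩
      · exact Or.inl (.cons h')
      · exact Or.inr ⟨rfl, h'⟩

lemma prec_mul {u v z z' : FreeMonoid (Fin 2)} (hu : len u = len z) (h : prec (u * v) (z * z')) :
    prec u z ∨ (u = z ∧ prec v z') := by
  obtain ⟨h1, h2⟩ := h
  rw [len_mul, len_mul] at h1
  rw [FreeMonoid.toList_mul, FreeMonoid.toList_mul] at h2
  rcases List.Lex.of_append hu h2 with h | ⟨h, h'⟩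
  · exact Or.inl ⟨hu, h⟩
  · exact Or.inr ⟨FreeMonoid.toList.injective h, by omega, h'⟩

/-- The multidegree of a word in six letters. -/
def cnt (v : FreeMonoid (Fin 6)) : Fin 6 →₀ ℕ :=
  Finsupp.equivFunOnFinite.symm fun e => (FreeMonoid.toList v).count e

lemma cnt_mul (u v : FreeMonoid (Fin 6)) : cnt (u * v) = cnt u + cnt v := by
  ext e
  simp [cnt]

lemma sum_cnt (v : FreeMonoid (Fin 6)) : ∑ j, cnt v j = len v := by
  simp only [cnt, len, Finsupp.equivFunOnFinite_symm_apply_apply]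
  have := Multiset.sum_count_eq_card (s := Finset.univ)
    (m := (FreeMonoid.toList v : Multiset (Fin 6))) (by simp)
  simpa using this

/-- The generating polynomial, by multidegree, of a function on the words above `z`. -/
def gen (f : FreeMonoid (Fin 6) → K) (z : FreeMonoid (Fin 2)) : MvPolynomial (Fin 6) K :=
  ∑ v ∈ (wordsOf (len z)).filter (fun v => bm v = z), MvPolynomial.monomial (cnt v) (f v)

lemma gen_mul {z z' : FreeMonoid (Fin 2)} {f f' f'' : FreeMonoid (Fin 6) → K}
    (h : ∀ u v, len u = len z → len v = len z' → f'' (u * v) = f u * f' v) :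
    gen f'' (z * z') = gen f z * gen f' z' := by
  rw [gen, gen, gen, Finset.sum_mul_sum, ← Finset.sum_product']
  symm
  refine Finset.sum_nbij' (fun x => x.1 * x.2) (fun w => (takeW (len z) w, dropW (len z) w))
    ?_ ?_ ?_ ?_ ?_
  · rintro ⟨u, v⟩ h
    simp only [Finset.mem_product, Finset.mem_filter, mem_wordsOf] at h ⊢
    exact ⟨by rw [len_mul, len_mul, h.1.1, h.2.1], by rw [map_mul, h.1.2, h.2.2]⟩
  · intro w h
    simp only [Finset.mem_product, Finset.mem_filter, mem_wordsOf] at h ⊢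
    obtain ⟨h1, h2⟩ := h
    rw [len_mul] at h1
    have h3 := len_takeW h1
    rw [← takeW_mul_dropW (len z) w, map_mul] at h2
    obtain ⟨h4, h5⟩ := mul_inj_of_len (by rw [len_bm, h3]) h2
    exact ⟨⟨h3, h4⟩, len_dropW h1, h5⟩
  · rintro ⟨u, v⟩ h
    simp only [Finset.mem_product, Finset.mem_filter, mem_wordsOf] at h
    simp only [takeW_mul h.1.1, dropW_mul h.1.1]
  · intro w _
    exact takeW_mul_dropW _ w
  · rintro ⟨u, v⟩ hx
    simp only [Finset.mem_product, Finset.mem_filter, mem_wordsOf] at hx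
    rw [MvPolynomial.monomial_mul, cnt_mul, h u v hx.1.1 hx.2.1]

/-- The linear functional on the free algebra with prescribed values on words. -/
def ofWords (f : FreeMonoid (Fin 6) → K) : FreeA K →ₗ[K] K :=
  (Finsupp.linearCombination K f).comp (MonoidAlgebra.coeffLinearEquiv K).toLinearMap

lemma ofWords_single (f : FreeMonoid (Fin 6) → K) (v : FreeMonoid (Fin 6)) :
    ofWords f (MonoidAlgebra.single v 1) = f v := by
  simp [ofWords]

/-- The tensor product of two functionals, the first one applied to the first `p` letters. -/
def cat (p : ℕ) (φ φ' : FreeA K →ₗ[K] K) : FreeA K →ₗ[K] K :=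
  ofWords fun v => φ (MonoidAlgebra.single (takeW p v) 1) * φ' (MonoidAlgebra.single (dropW p v) 1)

lemma span_single_eq_top :
    Submodule.span K (Set.range fun v : FreeMonoid (Fin 6) => (MonoidAlgebra.single v 1 : FreeA K))
      = ⊤ := by
  rw [eq_top_iff]
  rintro a -
  induction a using MonoidAlgebra.induction_linear with
  | zero => exact zero_mem _
  | add a b ha hb => exact add_mem ha hb
  | single v r =>
    have : (MonoidAlgebra.single v r : FreeA K) = r • MonoidAlgebra.single v 1 := by simp
    rw [this]
    exact Submodule.smul_mem _ _ (Submodule.subset_span ⟨v, rfl⟩)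

lemma cat_mul {p : ℕ} (φ φ' : FreeA K →ₗ[K] K) {a : FreeA K} (ha : a ∈ Hgr K p) (b : FreeA K) :
    cat p φ φ' (a * b) = φ a * φ' b := by
  have hb : b ∈ Submodule.span K
      (Set.range fun v : FreeMonoid (Fin 6) => (MonoidAlgebra.single v 1 : FreeA K)) := by
    rw [span_single_eq_top]; trivial
  induction ha using Submodule.span_induction with
  | zero => simp
  | add x y _ _ hx hy => rw [add_mul, map_add, hx, hy, map_add, add_mul]
  | smul r x _ hx => rw [smul_mul_assoc, map_smul, hx, map_smul, smul_mul_assoc]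
  | mem x hx =>
    obtain ⟨u, hu, rfl⟩ := hx
    induction hb using Submodule.span_induction with
    | zero => simp
    | add x y _ _ hx hy => rw [mul_add, map_add, hx, hy, map_add, mul_add]
    | smul r x _ hx => rw [mul_smul_comm, map_smul, hx, map_smul, mul_smul_comm]
    | mem x hx =>
      obtain ⟨v, rfl⟩ := hx
      simp only [MonoidAlgebra.single_mul_single, mul_one, cat, ofWords_single,
        takeW_mul hu, dropW_mul hu]

/-- Some functional that kills `f v` for every word `v` below `z` has generating polynomial `g`
on the words above `z`. -/
def Realizes (f : FreeMonoid (Fin 6) → FreeA K) (z : FreeMonoid (Fin 2))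
    (g : MvPolynomial (Fin 6) K) : Prop :=
  ∃ φ : FreeA K →ₗ[K] K, (∀ v, prec (bm v) z → φ (f v) = 0) ∧ gen (fun v => φ (f v)) z = g

lemma Realizes.mul {f f' f'' : FreeMonoid (Fin 6) → FreeA K} {z z' : FreeMonoid (Fin 2)}
    {g g' : MvPolynomial (Fin 6) K} (h : Realizes f z g) (h' : Realizes f' z' g')
    (hH : ∀ u, len u = len z → f u ∈ Hgr K (len z))
    (hf : ∀ u v, len u = len z → len v = len z' → f'' (u * v) = f u * f' v) :
    Realizes f'' (z * z') (g * g') := by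
  obtain ⟨φ, hφ, rfl⟩ := h
  obtain ⟨φ', hφ', rfl⟩ := h'
  have key : ∀ u v, len u = len z → len v = len z' →
      cat (len z) φ φ' (f'' (u * v)) = φ (f u) * φ' (f' v) := by
    intro u v hu hv
    rw [hf u v hu hv, cat_mul _ _ (hH u hu)]
  refine ⟨cat (len z) φ φ', ?_, gen_mul key⟩
  intro v hv
  have hl : len v = len z + len z' := by rw [← len_bm, hv.1, len_mul]
  have h1 := len_takeW hl
  rw [← takeW_mul_dropW (len z) v, map_mul] at hv
  rw [← takeW_mul_dropW (len z) v, key _ _ h1 (len_dropW hl)]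
  rcases prec_mul (by rw [len_bm, h1]) hv with h | ⟨-, h⟩
  · rw [hφ _ h, zero_mul]
  · rw [hφ' _ h, mul_zero]

/-- Up to a nonzero common factor, all monomials of some bidegree `(a, b)` with `L ≤ a + b` are
realized. -/
def RealizesBox (f : FreeMonoid (Fin 6) → FreeA K) (z : FreeMonoid (Fin 2)) (L : ℕ) : Prop :=
  ∃ g : MvPolynomial (Fin 6) K, g ≠ 0 ∧ ∃ a b : ℕ, L ≤ a + b ∧
    ∀ d : Fin 6 →₀ ℕ, d 0 + d 1 + d 2 = a → d 3 + d 4 + d 5 = b →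
      Realizes f z (g * MvPolynomial.monomial d 1)

lemma exists_triple_le {x y z a a' : ℕ} (h : x + y + z = a + a') :
    ∃ x' y' z', x' ≤ x ∧ y' ≤ y ∧ z' ≤ z ∧ x' + y' + z' = a :=
  ⟨min x a, min y (a - min x a), a - min x a - min y (a - min x a), by omega, by omega, by omega,
    by omega⟩

/-- The multidegree with the given entries. -/
def mdeg (x y z u v w : ℕ) : Fin 6 →₀ ℕ := Finsupp.equivFunOnFinite.symm ![x, y, z, u, v, w]

lemma exists_split {d : Fin 6 →₀ ℕ} {a a' b b' : ℕ} (h1 : d 0 + d 1 + d 2 = a + a')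
    (h2 : d 3 + d 4 + d 5 = b + b') :
    ∃ e e' : Fin 6 →₀ ℕ, d = e + e' ∧ e 0 + e 1 + e 2 = a ∧ e 3 + e 4 + e 5 = b ∧
      e' 0 + e' 1 + e' 2 = a' ∧ e' 3 + e' 4 + e' 5 = b' := by
  obtain ⟨x, y, z, hx, hy, hz, h3⟩ := exists_triple_le h1
  obtain ⟨u, v, w, hu, hv, hw, h4⟩ := exists_triple_le h2
  refine ⟨mdeg x y z u v w,
    mdeg (d 0 - x) (d 1 - y) (d 2 - z) (d 3 - u) (d 4 - v) (d 5 - w), ?_, ?_⟩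
  · ext j
    fin_cases j <;> simp [mdeg] <;> omega
  · simp [mdeg]
    omega

lemma RealizesBox.mul {f f' f'' : FreeMonoid (Fin 6) → FreeA K} {z z' : FreeMonoid (Fin 2)}
    {L L' : ℕ} (h : RealizesBox f z L) (h' : RealizesBox f' z' L')
    (hH : ∀ u, len u = len z → f u ∈ Hgr K (len z))
    (hf : ∀ u v, len u = len z → len v = len z' → f'' (u * v) = f u * f' v) :
    RealizesBox f'' (z * z') (L + L') := by
  obtain ⟨g, hg, a, b, hL, H⟩ := h
  obtain ⟨g', hg', a', b', hL', H'⟩ := h'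
  refine ⟨g * g', mul_ne_zero hg hg', a + a', b + b', by omega, fun d hd1 hd2 => ?_⟩
  obtain ⟨e, e', rfl, h1, h2, h3, h4⟩ := exists_split hd1 hd2
  have := (H e h1 h2).mul (H' e' h3 h4) hH hf
  rwa [mul_mul_mul_comm, MvPolynomial.monomial_mul, mul_one] at this

lemma Realizes.box {f : FreeMonoid (Fin 6) → FreeA K} {z : FreeMonoid (Fin 2)}
    {g : MvPolynomial (Fin 6) K} (hg : g ≠ 0) (h : Realizes f z g) : RealizesBox f z 0 := by
  refine ⟨g, hg, 0, 0, le_rfl, fun d h1 h2 => ?_⟩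
  have : d = 0 := by
    ext j
    fin_cases j <;> simp <;> omega
  subst this
  simpa using h

/-- `f` applied to the first `k` blocks of length `p` of a word, multiplied together. -/
def blocks (f : FreeMonoid (Fin 6) → FreeA K) (p : ℕ) : ℕ → FreeMonoid (Fin 6) → FreeA K
  | 0, _ => 1
  | k + 1, v => f (takeW p v) * blocks f p k (dropW p v)

lemma blocks_prod (f : FreeMonoid (Fin 6) → FreeA K) (p : ℕ) :
    ∀ l : List (FreeMonoid (Fin 6)), (∀ w ∈ l, len w = p) →
      blocks f p l.length l.prod = (l.map f).prod
  | [], _ => rfl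
  | u :: l, h => by
    have hu : len u = p := h u (by simp)
    rw [List.length_cons, blocks, List.prod_cons, takeW_mul hu, dropW_mul hu,
      blocks_prod f p l fun w hw => h w (by simp [hw]), List.map_cons, List.prod_cons]

lemma exists_prod_eq {α : Type} (p : ℕ) : ∀ (k : ℕ) (v : FreeMonoid α), len v = k * p →
    ∃ l : List (FreeMonoid α), l.length = k ∧ (∀ w ∈ l, len w = p) ∧ l.prod = v
  | 0, v, h => ⟨[], rfl, by simp, by
      have : FreeMonoid.toList v = [] := List.length_eq_zero_iff.1 (by simpa [len] using h)
      exact FreeMonoid.toList.injective this.symm⟩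
  | k + 1, v, h => by
    have h' : len v = p + k * p := by rw [h]; ring
    obtain ⟨l, h1, h2, h3⟩ := exists_prod_eq p k (dropW p v) (len_dropW h')
    refine ⟨takeW p v :: l, by simp [h1], ?_, by rw [List.prod_cons, h3, takeW_mul_dropW]⟩
    intro w hw
    rcases List.mem_cons.1 hw with rfl | hw
    · exact len_takeW h'
    · exact h2 w hw

lemma len_one {α : Type} : len (1 : FreeMonoid α) = 0 := rfl

lemma realizes_one (f : FreeMonoid (Fin 6) → FreeA K) (p : ℕ) : Realizes (blocks f p 0) 1 1 := by
  refine ⟨ofWords fun _ => 1, fun v hv => ?_, ?_⟩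
  · have h1 : bm v = 1 := FreeMonoid.toList.injective (List.length_eq_zero_iff.1 hv.1)
    rw [h1] at hv
    exact absurd hv (not_prec_self _)
  · have : (wordsOf (len (1 : FreeMonoid (Fin 2)))).filter (fun v => bm v = 1) = {1} := by
      ext v
      simp only [Finset.mem_filter, mem_wordsOf, Finset.mem_singleton]
      constructor
      · rintro ⟨h, -⟩
        exact FreeMonoid.toList.injective (List.length_eq_zero_iff.1 h)
      · rintro rfl
        exact ⟨rfl, map_one _⟩
    rw [gen, this, Finset.sum_singleton]
    have h1 : cnt 1 = 0 := by ext; simp [cnt]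
    rw [h1, blocks, MonoidAlgebra.one_def, ofWords_single]
    rfl

lemma RealizesBox.blocks {f : FreeMonoid (Fin 6) → FreeA K} {p L : ℕ}
    (hH : ∀ u, len u = p → f u ∈ Hgr K p)
    (h : ∀ z, len z = p → RealizesBox f z L) :
    ∀ (k : ℕ) (z : FreeMonoid (Fin 2)), len z = k * p → RealizesBox (blocks f p k) z (k * L)
  | 0, z, hz => by
    have : z = 1 := FreeMonoid.toList.injective (List.length_eq_zero_iff.1 (hz.trans (Nat.zero_mul p)))
    subst this
    simpa using (realizes_one f p).box one_ne_zero
  | k + 1, z, hz => by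
    have hz' : len z = p + k * p := by rw [hz]; ring
    have h1 := len_takeW hz'
    have := RealizesBox.mul (f'' := _root_.blocks f p (k + 1)) (h _ h1)
      (RealizesBox.blocks hH h k _ (len_dropW hz')) (by rwa [h1]) (by
        intro u v hu _
        rw [h1] at hu
        rw [_root_.blocks, takeW_mul hu, dropW_mul hu])
    rw [takeW_mul_dropW] at this
    convert this using 1
    ring

lemma gen_sum {ι : Type} [Fintype ι] (α : ι → K) (f : ι → FreeMonoid (Fin 6) → K)
    (z : FreeMonoid (Fin 2)) :
    gen (fun v => ∑ j, α j * f j v) z = ∑ j, α j • gen (f j) z := by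
  simp only [gen, Finset.smul_sum, MvPolynomial.smul_monomial, smul_eq_mul, map_sum]
  rw [Finset.sum_comm]

lemma sum_smul_monomial_ne_zero {ι : Type} [Fintype ι] {d : ι → Fin 6 →₀ ℕ}
    (hd : Function.Injective d) {α : ι → K} (hα : α ≠ 0) :
    ∑ j, α j • MvPolynomial.monomial (d j) (1 : K) ≠ 0 := by
  obtain ⟨i, hi⟩ := Function.ne_iff.1 hα
  intro h
  apply hi
  have := congrArg (MvPolynomial.coeff (d i)) h
  simpa [MvPolynomial.coeff_sum, MvPolynomial.coeff_monomial, hd.eq_iff] using this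

/-- If more monomials are realized by `f` than there are elements in `s`, a nonzero polynomial is
realized after composing with a map whose kernel is spanned by `s`. -/
lemma exists_realizes_comp {ι : Type} [Fintype ι] {f : FreeMonoid (Fin 6) → FreeA K}
    {z : FreeMonoid (Fin 2)} {g : MvPolynomial (Fin 6) K} (hg : g ≠ 0) {d : ι → Fin 6 →₀ ℕ}
    (hd : Function.Injective d) (h : ∀ j, Realizes f z (g * MvPolynomial.monomial (d j) 1))
    (hH : ∀ u, len u = len z → f u ∈ Hgr K (len z)) (c r : FreeA K →ₗ[K] FreeA K)
    (s : Finset (FreeA K)) (hs : s.card < Fintype.card ι)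
    (hc : ∀ a ∈ Hgr K (len z), c a = 0 → a ∈ Submodule.span K (r '' (s : Set (FreeA K)))) :
    ∃ g' : MvPolynomial (Fin 6) K, g' ≠ 0 ∧ Realizes (fun v => c (f v)) z g' := by
  choose φ hφ hgen using h
  let M : (ι → K) →ₗ[K] (s → K) :=
    LinearMap.pi fun x => ∑ j, (φ j (r x)) • LinearMap.proj j
  have hM : LinearMap.ker M ≠ ⊥ := LinearMap.ker_ne_bot_of_finrank_lt (by simpa using hs)
  obtain ⟨α, hα, hα0⟩ := (Submodule.ne_bot_iff _).1 hM
  let ψ : FreeA K →ₗ[K] K := ∑ j, α j • φ j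
  have hψ : ∀ a ∈ Submodule.span K (r '' (s : Set (FreeA K))), ψ a = 0 := by
    intro a ha
    have : Submodule.span K (r '' (s : Set (FreeA K))) ≤ LinearMap.ker ψ := by
      rw [Submodule.span_le]
      rintro _ ⟨x, hx, rfl⟩
      have := congrFun (LinearMap.mem_ker.1 hα) ⟨x, hx⟩
      simpa [M, ψ, mul_comm] using this
    exact this ha
  have hrange : ψ.comp (Hgr K (len z)).subtype ∈
      LinearMap.range (c.comp (Hgr K (len z)).subtype).dualMap := by
    rw [LinearMap.range_dualMap_eq_dualAnnihilator_ker, Submodule.mem_dualAnnihilator]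
    rintro ⟨a, ha⟩ hca
    exact hψ a (hc a ha hca)
  obtain ⟨φ', hφ'⟩ := hrange
  have key : ∀ v, len v = len z → φ' (c (f v)) = ∑ j, α j * φ j (f v) := by
    intro v hv
    have := LinearMap.congr_fun hφ' ⟨f v, hH v hv⟩
    simpa [ψ] using this
  refine ⟨g * ∑ j, α j • MvPolynomial.monomial (d j) (1 : K),
    mul_ne_zero hg (sum_smul_monomial_ne_zero hd hα0), φ', ?_, ?_⟩
  · intro v hv
    rw [key v (by rw [← len_bm, hv.1])]
    exact Finset.sum_eq_zero fun j _ => by rw [hφ j v hv, mul_zero]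
  · have : gen (fun v => φ' (c (f v))) z = gen (fun v => ∑ j, α j * φ j (f v)) z := by
      refine Finset.sum_congr rfl fun v hv => ?_
      exact congrArg _ (key v (mem_wordsOf.1 (Finset.mem_filter.1 hv).1))
    rw [this, gen_sum, Finset.mul_sum]
    exact Finset.sum_congr rfl fun j _ => by rw [hgen, mul_smul_comm]

/-- There are quadratically many multidegrees of a given bidegree. -/
lemma exists_mdeg_family {a b q : ℕ} (h : 4 * q ≤ a + b) :
    ∃ d : Fin q × Fin q → Fin 6 →₀ ℕ, Function.Injective d ∧
      ∀ j, d j 0 + d j 1 + d j 2 = a ∧ d j 3 + d j 4 + d j 5 = b := by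
  rcases le_total b a with hab | hab
  · refine ⟨fun j => mdeg j.1 j.2 (a - j.1 - j.2) b 0 0, ?_, ?_⟩
    · rintro ⟨x, y⟩ ⟨x', y'⟩ hxy
      have h0 := DFunLike.congr_fun hxy 0
      have h1 := DFunLike.congr_fun hxy 1
      simp [mdeg] at h0 h1
      ext <;> simp <;> omega
    · rintro ⟨x, y⟩
      have := x.2
      have := y.2
      simp [mdeg]
      omega
  · refine ⟨fun j => mdeg a 0 0 j.1 j.2 (b - j.1 - j.2), ?_, ?_⟩
    · rintro ⟨x, y⟩ ⟨x', y'⟩ hxy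
      have h0 := DFunLike.congr_fun hxy 3
      have h1 := DFunLike.congr_fun hxy 4
      simp [mdeg] at h0 h1
      ext <;> simp <;> omega
    · rintro ⟨x, y⟩
      have := x.2
      have := y.2
      simp [mdeg]
      omega

lemma exists_word (z : FreeMonoid (Fin 2)) : ∃ a b, a + b = len z ∧ ∀ d : Fin 6 →₀ ℕ,
    d 0 + d 1 + d 2 = a → d 3 + d 4 + d 5 = b → ∃ v, bm v = z ∧ cnt v = d := by
  induction z using FreeMonoid.inductionOn' with
  | one =>
    refine ⟨0, 0, rfl, fun d h1 h2 => ⟨1, map_one _, ?_⟩⟩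
    ext j
    fin_cases j <;> simp [cnt] <;> omega
  | of_mul x z ih =>
    obtain ⟨a, b, hab, H⟩ := ih
    have step : ∀ (d : Fin 6 →₀ ℕ) (e : Fin 6), bf e = x → (∃ d' : Fin 6 →₀ ℕ,
        d = Finsupp.single e 1 + d' ∧ d' 0 + d' 1 + d' 2 = a ∧ d' 3 + d' 4 + d' 5 = b) →
        ∃ v, bm v = FreeMonoid.of x * z ∧ cnt v = d := by
      rintro d e he ⟨d', rfl, h1, h2⟩
      obtain ⟨v, rfl, rfl⟩ := H d' h1 h2
      refine ⟨FreeMonoid.of e * v, by rw [map_mul, ← he]; rfl, ?_⟩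
      rw [cnt_mul]
      congr 1
      ext j
      simp [cnt, Finsupp.single_apply, List.count_singleton]
    have sub : ∀ (d : Fin 6 →₀ ℕ) (e : Fin 6), d e ≠ 0 →
        d = Finsupp.single e 1 + (d - Finsupp.single e 1) := by
      intro d e he
      ext j
      by_cases hj : e = j
      · subst hj; simp; omega
      · simp [hj]
    fin_cases x
    · refine ⟨a + 1, b, by rw [len_mul, ← hab]; simp [len]; ring, fun d h1 h2 => ?_⟩
      by_cases h : d 0 ≠ 0
      · exact step d 0 rfl ⟨_, sub d 0 h, by simp; omega, by simp; omega⟩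
      by_cases h' : d 1 ≠ 0
      · exact step d 1 rfl ⟨_, sub d 1 h', by simp; omega, by simp; omega⟩
      · exact step d 2 rfl ⟨_, sub d 2 (by omega), by simp; omega, by simp; omega⟩
    · refine ⟨a, b + 1, by rw [len_mul, ← hab]; simp [len]; ring, fun d h1 h2 => ?_⟩
      by_cases h : d 3 ≠ 0
      · exact step d 3 rfl ⟨_, sub d 3 h, by simp; omega, by simp; omega⟩
      by_cases h' : d 4 ≠ 0
      · exact step d 4 rfl ⟨_, sub d 4 h', by simp; omega, by simp; omega⟩
      · exact step d 5 rfl ⟨_, sub d 5 (by omega), by simp; omega, by simp; omega⟩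

lemma realizesBox_single {f : FreeMonoid (Fin 6) → FreeA K} (z : FreeMonoid (Fin 2))
    (hf : ∀ v, len v = len z → f v = MonoidAlgebra.single v 1) : RealizesBox f z (len z) := by
  obtain ⟨a, b, hab, H⟩ := exists_word z
  refine ⟨1, one_ne_zero, a, b, hab.ge, fun d h1 h2 => ?_⟩
  obtain ⟨v, rfl, rfl⟩ := H d h1 h2
  refine ⟨ofWords (Pi.single v 1), fun w hw => ?_, ?_⟩
  · rw [hf w (by rw [← len_bm, hw.1]), ofWords_single, Pi.single_eq_of_ne]
    rintro rfl
    exact not_prec_self _ hw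
  · rw [one_mul, gen, Finset.sum_eq_single v]
    · rw [hf v (len_bm v).symm, ofWords_single, Pi.single_eq_same]
    · intro w hw hwv
      rw [hf w (mem_wordsOf.1 (Finset.mem_filter.1 hw).1), ofWords_single,
        Pi.single_eq_of_ne hwv, map_zero]
    · intro h
      exact absurd (by simp [mem_wordsOf, len_bm]) h

lemma Realizes.exists_notMem {R : FreeA K →ₗ[K] FreeA K} {z : FreeMonoid (Fin 2)}
    {g : MvPolynomial (Fin 6) K} (hg : g ≠ 0)
    (h : Realizes (fun v => R (MonoidAlgebra.single v 1)) z g) :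
    ∃ n : Fin 6 → ℕ, (∑ j, n j) = len z ∧
      R (wComp K z (fun j => (n j : ℤ))) ∉ Submodule.map R (SP K z) := by
  obtain ⟨φ, hφ, rfl⟩ := h
  obtain ⟨n, hn⟩ := MvPolynomial.ne_zero_iff.1 hg
  rw [gen, MvPolynomial.coeff_sum] at hn
  refine ⟨n, ?_, ?_⟩
  · obtain ⟨v, hv, hv0⟩ := Finset.exists_ne_zero_of_sum_ne_zero hn
    rw [MvPolynomial.coeff_monomial] at hv0
    have h1 : cnt v = n := by
      by_contra h
      simp [h] at hv0
    rw [← h1, sum_cnt]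
    exact mem_wordsOf.1 (Finset.mem_filter.1 hv).1
  · rintro ⟨a, ha, hRa⟩
    have h0 : φ (R a) = 0 := by
      have : SP K z ≤ LinearMap.ker (φ.comp R) := by
        rw [SP, Submodule.span_le]
        rintro _ ⟨w, -, hw, rfl⟩
        exact hφ w hw
      exact this ha
    apply hn
    rw [← h0, hRa, wComp, map_sum, map_sum, ← Finset.filter_filter, Finset.sum_filter (p := fun v =>
      ∀ e : Fin 6, ((FreeMonoid.toList v).count e : ℤ) = n e)]
    refine Finset.sum_congr rfl fun v _ => ?_
    rw [MvPolynomial.coeff_monomial]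
    refine if_congr ?_ rfl rfl
    rw [Finsupp.ext_iff]
    simp [cnt]

/-- Passing from one scale to the next loses one of the `k` blocks. -/
lemma RealizesBox.step {R R' c : FreeA K →ₗ[K] FreeA K} {p k L : ℕ} {F : Finset (FreeA K)}
    (hRH : ∀ a ∈ Hgr K p, R a ∈ Hgr K p) (hcH : ∀ a ∈ Hgr K p, c a ∈ Hgr K p)
    (hcker : ∀ a ∈ Hgr K p, c a = 0 → a ∈ Submodule.span K (R '' (F : Set (FreeA K))))
    (hrec : ∀ l : List (FreeMonoid (Fin 6)), l.length = k + 1 → (∀ w ∈ l, len w = p) →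
      R' (MonoidAlgebra.single l.prod 1) = c (R (MonoidAlgebra.single l.headI 1)) *
          (l.tail.map fun w => R (MonoidAlgebra.single w 1)).prod)
    (hF : F.card < (L / 4) * (L / 4))
    (h : ∀ z, len z = p → RealizesBox (fun v => R (MonoidAlgebra.single v 1)) z L)
    (z : FreeMonoid (Fin 2)) (hz : len z = (k + 1) * p) :
    RealizesBox (fun v => R' (MonoidAlgebra.single v 1)) z (k * L) := by
  have hH : ∀ u, len u = p → R (MonoidAlgebra.single u 1) ∈ Hgr K p := fun u hu =>
    hRH _ (Submodule.subset_span ⟨u, hu, rfl⟩)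
  have hz' : len z = p + k * p := by rw [hz]; ring
  have h1 := len_takeW hz'
  obtain ⟨g, hg, a, b, hL, H⟩ := h _ h1
  obtain ⟨d, hd, hdj⟩ := exists_mdeg_family (a := a) (b := b) (q := L / 4) (by omega)
  obtain ⟨g', hg', hr⟩ := exists_realizes_comp hg hd (fun j => H _ (hdj j).1 (hdj j).2)
    (by rwa [h1]) c R F (by simpa using hF) (by rwa [h1])
  have := RealizesBox.mul (f'' := fun v => R' (MonoidAlgebra.single v 1)) (hr.box hg')
    (RealizesBox.blocks hH h k _ (len_dropW hz'))
    (by rw [h1]; exact fun u hu => hcH _ (hH u hu)) (by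
      intro u v hu hv
      rw [h1] at hu
      rw [len_dropW hz'] at hv
      obtain ⟨l, hl, hlp, rfl⟩ := exists_prod_eq p k v hv
      have := hrec (u :: l) (by simp [hl]) (by
        intro w hw
        rcases List.mem_cons.1 hw with rfl | hw
        · exact hu
        · exact hlp w hw)
      rw [List.prod_cons] at this
      rw [this, ← hl, blocks_prod _ _ _ hlp]
      rfl)
  rwa [takeW_mul_dropW, zero_add] at this

end

theorem stmt14 (K : Type) [Field K] (m : ℕ → ℕ)
    (hmono : StrictMono m) (hm1 : 10 ^ 8 < m 0)
    (hdvd : ∀ i, 40 * m i ∣ m (i + 1)) (hgrow : ∀ i, 2 ^ (i + 102) * m i < m (i + 1))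
    (F : ℕ → Finset (FreeA K)) (hF : ∀ i, (F i : Set (FreeA K)) ⊆ (Hgr K (m i) : Set (FreeA K)))
    (hcard : ∀ i, 10 ^ 4 * (F i).card < (m i) ^ 2)
    (R c : ℕ → (FreeA K →ₗ[K] FreeA K))
    (hR0 : ∀ a ∈ Hgr K (m 0), R 0 a = a)
    (hRH : ∀ i, ∀ a ∈ Hgr K (m i), R i a ∈ Hgr K (m i))
    (hcH : ∀ i, ∀ a ∈ Hgr K (m i), c i a ∈ Hgr K (m i))
    (hcker : ∀ i, ∀ a ∈ Hgr K (m i),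
      (c i a = 0 ↔ a ∈ Submodule.span K (⇑(R i) '' (F i : Set (FreeA K)))))
    (hrec : ∀ (i : ℕ) (l : List (FreeMonoid (Fin 6))),
      l.length = m (i + 1) / m i → (∀ w ∈ l, len w = m i) →
      R (i + 1) (MonoidAlgebra.single l.prod 1) =
        c i (R i (MonoidAlgebra.single l.headI 1)) *
          (l.tail.map fun w => R i (MonoidAlgebra.single w 1)).prod) :
    ∀ (i : ℕ) (z : FreeMonoid (Fin 2)), len z = m i →
      ∃ n : Fin 6 → ℕ, (∑ j, n j) = m i ∧
        R i (wComp K z (fun j => (n j : ℤ))) ∉ Submodule.map (R i) (SP K z) := by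
  classical
  have hmpos : ∀ i, 10 ^ 8 < m i := fun i => hm1.trans_le (hmono.monotone (Nat.zero_le i))
  have main : ∀ i, ∃ L, (2 ^ i + 1) * m i ≤ 2 ^ (i + 1) * L ∧ ∀ z, len z = m i →
      RealizesBox (fun v => R i (MonoidAlgebra.single v 1)) z L := by
    intro i
    induction i with
    | zero =>
      refine ⟨m 0, by norm_num, fun z hz => ?_⟩
      rw [← hz]
      exact realizesBox_single z fun v hv => hR0 _ (Submodule.subset_span ⟨v, hv.trans hz, rfl⟩)
    | succ i ih =>
      obtain ⟨L, hL, H⟩ := ih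
      have hp := hmpos i
      obtain ⟨k', hk'⟩ := (Dvd.intro_left 40 rfl).trans (hdvd i)
      have hgr := hgrow i
      rw [hk', mul_comm (m i)] at hgr
      have hk := Nat.lt_of_mul_lt_mul_right hgr
      obtain ⟨k, rfl⟩ : ∃ k, k' = k + 1 := ⟨k' - 1, by have := Nat.zero_le (2 ^ (i + 102)); omega⟩
      have hdiv : m (i + 1) / m i = k + 1 := by
        rw [hk', Nat.mul_div_cancel_left _ (by omega)]
      have h2L : m i ≤ 2 * L := by
        have : 2 ^ i * m i ≤ 2 ^ i * (2 * L) := by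
          calc 2 ^ i * m i ≤ (2 ^ i + 1) * m i := Nat.mul_le_mul_right _ (by omega)
            _ ≤ _ := hL
            _ = _ := by ring
        exact Nat.le_of_mul_le_mul_left this (by positivity)
      refine ⟨k * L, ?_, fun z hz => ?_⟩
      · have h4 : 2 ^ (i + 1) + 1 ≤ k := by
          have : 2 ^ (i + 1) * 2 ^ 101 = 2 ^ (i + 102) := by rw [← pow_add]
          have : 1 ≤ 2 ^ (i + 1) := Nat.one_le_two_pow
          omega
        calc (2 ^ (i + 1) + 1) * m (i + 1) = (2 ^ (i + 1) + 1) * (k + 1) * m i := by rw [hk']; ring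
          _ ≤ 2 * k * (2 ^ i + 1) * m i := by
              refine Nat.mul_le_mul_right _ ?_
              rw [pow_succ] at h4 ⊢
              nlinarith
          _ = 2 * k * ((2 ^ i + 1) * m i) := by ring
          _ ≤ 2 * k * (2 ^ (i + 1) * L) := Nat.mul_le_mul_left _ hL
          _ = _ := by ring
      · refine RealizesBox.step (hRH i) (hcH i) (fun a ha h => (hcker i a ha).1 h)
          (fun l hl hw => hrec i l (by rw [hdiv, hl]) hw) ?_ H z (by rw [hz, hk', mul_comm])
        have hc := hcard i
        have hq : m i ≤ 10 * (L / 4) := by omega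
        nlinarith [Nat.mul_le_mul hq hq]
  intro i z hz
  obtain ⟨L, -, H⟩ := main i
  obtain ⟨g, hg, a, b, -, h⟩ := H z hz
  rw [← hz]
  refine Realizes.exists_notMem (mul_ne_zero hg ?_) (h (mdeg a 0 0 b 0 0) ?_ ?_)
  · simp [MvPolynomial.monomial_eq_zero]
  · simp [mdeg]
  · simp [mdeg]
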